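/- Let G be a graph containing two cycles C and C' with distinct edge sets, and suppose the intersection of C and C' contains at least two distinct vertices. Then there exist two distinct vertices v1 and v2 lying on both C and C', together with three pairwise internally disjoint paths from v1 to v2 whose edges all lie in C ∪ C'. -/

import Mathlib

open SimpleGraph in
theorem aux_split {V : Type*} {G : SimpleGraph V} {u v w : V} (c : G.Walk u u)
    (hc : c.IsCycle) (hv : v ∈ c.support) (hw : w ∈ c.support) (hvw : v ≠ w) :
    ∃ (p : G.Walk v w) (q : G.Walk w v), p.IsPath ∧ q.IsPath ∧
      (∀ e, e ∈ c.edges ↔ e ∈ p.edges ∨ e ∈ q.edges) ∧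
      (∀ x ∈ p.support, x ∈ c.support) ∧ (∀ x ∈ q.support, x ∈ c.support) ∧
      (∀ e ∈ p.edges, e ∉ q.edges) ∧
      (∀ x ∈ p.support, x ∈ q.support → x = v ∨ x = w) := by
  classical
  have hc1 : (c.rotate v hv).IsCycle := hc.rotate hv
  have hsup : ∀ x, x ∈ (c.rotate v hv).support ↔ x ∈ c.support := fun x => by
    simp
  have hed : ∀ e, e ∈ (c.rotate v hv).edges ↔ e ∈ c.edges := fun e =>
    (c.rotate_edges v hv).mem_iff
  generalize c.rotate v hv = d at hc1 hsup hed
  have hwd : w ∈ d.support := (hsup w).2 hw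
  obtain ⟨p, q, rfl⟩ := Walk.mem_support_iff_exists_append.1 hwd
  have hnd := hc1.support_nodup
  have hed2 := hc1.edges_nodup
  have htail : (p.append q).support.tail = p.support.tail ++ q.support.tail :=
    Walk.tail_support_append p q
  rw [htail, List.nodup_append] at hnd
  rw [Walk.edges_append, List.nodup_append] at hed2
  obtain ⟨h1, h2, h3⟩ := hnd
  have hp : w ∈ p.support.tail := by
    have := p.end_mem_support
    rw [Walk.mem_support_iff] at this
    exact this.resolve_left hvw.symm
  have hq : v ∈ q.support.tail := by
    have := q.end_mem_support
    rw [Walk.mem_support_iff] at this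
    exact this.resolve_left hvw
  refine ⟨p, q, ?_, ?_, ?_, ?_, ?_, ?_, ?_⟩
  · rw [Walk.isPath_def, Walk.support_eq_cons, List.nodup_cons]
    exact ⟨fun h => h3 _ h _ hq rfl, h1⟩
  · rw [Walk.isPath_def, Walk.support_eq_cons, List.nodup_cons]
    exact ⟨fun h => h3 _ hp _ h rfl, h2⟩
  · intro e
    rw [← hed, Walk.edges_append, List.mem_append]
  · intro x hx
    rw [← hsup, Walk.mem_support_append_iff]
    exact Or.inl hx
  · intro x hx
    rw [← hsup, Walk.mem_support_append_iff]
    exact Or.inr hx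
  · intro e he he'
    exact hed2.2.2 e he e he' rfl
  · intro x hx hx'
    rw [Walk.mem_support_iff] at hx hx'
    rcases hx with hx | hx
    · exact Or.inl hx
    rcases hx' with hx' | hx'
    · exact Or.inr hx'
    exact (h3 x hx x hx' rfl).elim

open SimpleGraph in
theorem aux_segment {V : Type*} {G : SimpleGraph V} (S : Set V) (e : Sym2 V) (n : ℕ) :
    ∀ {x y : V} (r : G.Walk x y), r.length ≤ n → r.IsPath → x ∈ S → y ∈ S → e ∈ r.edges →
    ∃ (a b : V) (t : G.Walk a b), t.IsPath ∧ a ∈ S ∧ b ∈ S ∧ e ∈ t.edges ∧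
      (∀ f ∈ t.edges, f ∈ r.edges) ∧ (∀ z ∈ t.support, z ∈ r.support) ∧
      (∀ z ∈ t.support, z ∈ S → z = a ∨ z = b) := by
  induction n with
  | zero =>
    intro x y r hr _ _ _ he
    have : r.edges.length = 0 := by rw [Walk.length_edges]; omega
    rw [List.length_eq_zero_iff] at this
    simp [this] at he
  | succ n ih =>
    intro x y r hr hpath hx hy he
    by_cases h : ∀ z ∈ r.support, z ∈ S → z = x ∨ z = y
    · exact ⟨x, y, r, hpath, hx, hy, he, fun _ h => h, fun _ h => h, h⟩
    · push Not at h
      obtain ⟨z, hz, hzS, hzx, hzy⟩ := h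
      obtain ⟨p, q, rfl⟩ := Walk.mem_support_iff_exists_append.1 hz
      have hp0 : p.length ≠ 0 := fun h => hzx (Walk.eq_of_length_eq_zero h).symm
      have hq0 : q.length ≠ 0 := fun h => hzy (Walk.eq_of_length_eq_zero h)
      rw [Walk.length_append] at hr
      rw [Walk.edges_append, List.mem_append] at he
      rcases he with he | he
      · obtain ⟨a, b, t, h1, h2, h3, h4, h5, h6, h7⟩ :=
          ih p (by omega) hpath.of_append_left hx hzS he
        refine ⟨a, b, t, h1, h2, h3, h4, fun f hf => ?_, fun f hf => ?_, h7⟩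
        · rw [Walk.edges_append, List.mem_append]
          exact Or.inl (h5 f hf)
        · rw [Walk.mem_support_append_iff]
          exact Or.inl (h6 f hf)
      · obtain ⟨a, b, t, h1, h2, h3, h4, h5, h6, h7⟩ :=
          ih q (by omega) hpath.of_append_right hzS hy he
        refine ⟨a, b, t, h1, h2, h3, h4, fun f hf => ?_, fun f hf => ?_, h7⟩
        · rw [Walk.edges_append, List.mem_append]
          exact Or.inr (h5 f hf)
        · rw [Walk.mem_support_append_iff]
          exact Or.inr (h6 f hf)

theorem aux_main {V : Type*} {G : SimpleGraph V}
    {u u' : V} (c : G.Walk u u) (c' : G.Walk u' u')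
    (hc : c.IsCycle) (hc' : c'.IsCycle)
    (hedges : ∃ e, e ∈ c'.edges ∧ e ∉ c.edges)
    (hvert : ∃ v w : V, v ≠ w ∧ v ∈ c.support ∧ v ∈ c'.support ∧
      w ∈ c.support ∧ w ∈ c'.support) :
    ∃ v₁ v₂ : V, v₁ ≠ v₂ ∧
      v₁ ∈ c.support ∧ v₁ ∈ c'.support ∧ v₂ ∈ c.support ∧ v₂ ∈ c'.support ∧
      ∃ p₁ p₂ p₃ : G.Walk v₁ v₂,
        p₁.IsPath ∧ p₂.IsPath ∧ p₃.IsPath ∧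
        p₁ ≠ p₂ ∧ p₁ ≠ p₃ ∧ p₂ ≠ p₃ ∧
        (∀ e ∈ p₁.edges, e ∈ c.edges ∨ e ∈ c'.edges) ∧
        (∀ e ∈ p₂.edges, e ∈ c.edges ∨ e ∈ c'.edges) ∧
        (∀ e ∈ p₃.edges, e ∈ c.edges ∨ e ∈ c'.edges) ∧
        (∀ v ∈ p₁.support, v ∈ p₂.support → v = v₁ ∨ v = v₂) ∧
        (∀ v ∈ p₁.support, v ∈ p₃.support → v = v₁ ∨ v = v₂) ∧
        (∀ v ∈ p₂.support, v ∈ p₃.support → v = v₁ ∨ v = v₂) := by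
  classical
  obtain ⟨e, hec', hec⟩ := hedges
  obtain ⟨v, w, hvw, hvc, hvc', hwc, hwc'⟩ := hvert
  obtain ⟨p, q, hp, hq, hE, hpS, hqS, -, -⟩ := aux_split c' hc' hvc' hwc' hvw
  have key : ∃ (a b : V) (t : G.Walk a b), t.IsPath ∧ a ∈ c.support ∧ b ∈ c.support ∧
      e ∈ t.edges ∧ (∀ f ∈ t.edges, f ∈ c'.edges) ∧ (∀ z ∈ t.support, z ∈ c'.support) ∧
      (∀ z ∈ t.support, z ∈ c.support → z = a ∨ z = b) := by
    rcases (hE e).1 hec' with he | he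
    · obtain ⟨a, b, t, h1, h2, h3, h4, h5, h6, h7⟩ :=
        aux_segment {z | z ∈ c.support} e p.length p le_rfl hp hvc hwc he
      exact ⟨a, b, t, h1, h2, h3, h4, fun f hf => (hE f).2 (Or.inl (h5 f hf)),
        fun z hz => hpS z (h6 z hz), h7⟩
    · obtain ⟨a, b, t, h1, h2, h3, h4, h5, h6, h7⟩ :=
        aux_segment {z | z ∈ c.support} e q.length q le_rfl hq hwc hvc he
      exact ⟨a, b, t, h1, h2, h3, h4, fun f hf => (hE f).2 (Or.inr (h5 f hf)),
        fun z hz => hqS z (h6 z hz), h7⟩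
  obtain ⟨a, b, t, ht, ha, hb, het, htE, htS, htc⟩ := key
  have hab : a ≠ b := by
    rintro rfl
    rw [SimpleGraph.Walk.isPath_iff_eq_nil] at ht
    subst ht
    simp at het
  obtain ⟨p, q, hp, hq, hE, hpS, hqS, hdis, hint⟩ := aux_split c hc ha hb hab
  refine ⟨a, b, hab, ha, htS a t.start_mem_support, hb, htS b t.end_mem_support,
    p, q.reverse, t, hp, hq.reverse, ht, ?_, ?_, ?_, ?_, ?_, ?_, ?_, ?_, ?_⟩
  · intro h
    have hne : p.edges ≠ [] := by
      intro h0
      have : p.length = 0 := by rw [← SimpleGraph.Walk.length_edges, h0]; rfl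
      exact hab (SimpleGraph.Walk.eq_of_length_eq_zero this)
    obtain ⟨f, hf⟩ := List.exists_mem_of_ne_nil _ hne
    have hf2 := hf
    rw [h, SimpleGraph.Walk.edges_reverse, List.mem_reverse] at hf2
    exact hdis f hf hf2
  · rintro rfl
    exact hec ((hE e).2 (Or.inl het))
  · rintro rfl
    rw [SimpleGraph.Walk.edges_reverse, List.mem_reverse] at het
    exact hec ((hE e).2 (Or.inr het))
  · intro f hf
    exact Or.inl ((hE f).2 (Or.inl hf))
  · intro f hf
    rw [SimpleGraph.Walk.edges_reverse, List.mem_reverse] at hf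
    exact Or.inl ((hE f).2 (Or.inr hf))
  · intro f hf
    exact Or.inr (htE f hf)
  · intro z hz hz'
    rw [SimpleGraph.Walk.support_reverse, List.mem_reverse] at hz'
    exact hint z hz hz'
  · intro z hz hz'
    exact htc z hz' (hpS z hz)
  · intro z hz hz'
    rw [SimpleGraph.Walk.support_reverse, List.mem_reverse] at hz
    exact htc z hz' (hqS z hz)

/-- If a graph `G` contains two cycles `C` and `C'` with distinct edge sets, whose
intersection contains at least two distinct vertices, then there are two distinct
vertices `v₁, v₂` lying on both cycles joined by three pairwise internally disjoint
paths all of whose edges lie in `C ∪ C'`. -/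
theorem three_internally_disjoint_paths {V : Type*} [Fintype V] {G : SimpleGraph V}
    {u u' : V} (c : G.Walk u u) (c' : G.Walk u' u')
    (hc : c.IsCycle) (hc' : c'.IsCycle)
    (hedges : {e : Sym2 V | e ∈ c.edges} ≠ {e : Sym2 V | e ∈ c'.edges})
    (hvert : ∃ v w : V, v ≠ w ∧ v ∈ c.support ∧ v ∈ c'.support ∧
      w ∈ c.support ∧ w ∈ c'.support) :
    ∃ v₁ v₂ : V, v₁ ≠ v₂ ∧
      v₁ ∈ c.support ∧ v₁ ∈ c'.support ∧ v₂ ∈ c.support ∧ v₂ ∈ c'.support ∧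
      ∃ p₁ p₂ p₃ : G.Walk v₁ v₂,
        p₁.IsPath ∧ p₂.IsPath ∧ p₃.IsPath ∧
        p₁ ≠ p₂ ∧ p₁ ≠ p₃ ∧ p₂ ≠ p₃ ∧
        (∀ e ∈ p₁.edges, e ∈ c.edges ∨ e ∈ c'.edges) ∧
        (∀ e ∈ p₂.edges, e ∈ c.edges ∨ e ∈ c'.edges) ∧
        (∀ e ∈ p₃.edges, e ∈ c.edges ∨ e ∈ c'.edges) ∧
        (∀ v ∈ p₁.support, v ∈ p₂.support → v = v₁ ∨ v = v₂) ∧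
        (∀ v ∈ p₁.support, v ∈ p₃.support → v = v₁ ∨ v = v₂) ∧
        (∀ v ∈ p₂.support, v ∈ p₃.support → v = v₁ ∨ v = v₂) := by
  by_cases h : ∃ e, e ∈ c'.edges ∧ e ∉ c.edges
  · exact aux_main c c' hc hc' h hvert
  · have h2 : ∃ e, e ∈ c.edges ∧ e ∉ c'.edges := by
      by_contra h2
      push Not at h h2
      exact hedges (Set.ext fun e => ⟨h2 e, h e⟩)
    obtain ⟨v, w, hvw, h3, h4, h5, h6⟩ := hvert
    obtain ⟨a, b, hab, k1, k2, k3, k4, p, q, r, l1, l2, l3, l4, l5, l6, m1, m2, m3, m⟩ :=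
      aux_main c' c hc' hc h2 ⟨v, w, hvw, h4, h3, h6, h5⟩
    exact ⟨a, b, hab, k2, k1, k4, k3, p, q, r, l1, l2, l3, l4, l5, l6,
      fun e he => (m1 e he).symm, fun e he => (m2 e he).symm, fun e he => (m3 e he).symm, m⟩
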